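/- Let R be an OR-free k-ary Boolean relation. If F is a flip sequence valid at s ∈ R, then there exists a valid flip sequence F' equivalent to F in which all negative flips occur before all positive flips, such that C(F') ⊆ C(F) and the relative order among flips of the same sign is preserved. -/

import Mathlib

def IsRestriction {k k' : ℕ} (R : Set (Fin k → Bool)) (R' : Set (Fin k' → Bool)) : Prop :=
  k' ≤ k ∧ ∃ X : Fin k → (Fin k' ⊕ Bool),
    ∀ r : Fin k' → Bool, r ∈ R' ↔ (fun i => Sum.elim r id (X i)) ∈ R

/-- The NAND relation `{01, 10, 00}`. -/
def nandRel : Set (Fin 2 → Bool) := {r | ¬(r 0 = true ∧ r 1 = true)}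

/-- The OR relation `{01, 10, 11}`. -/
def orRel : Set (Fin 2 → Bool) := {r | r 0 = true ∨ r 1 = true}

/-- The dual-Horn-clause relation `{0,1}^3 \ {100}`. -/
def dualHornRel : Set (Fin 3 → Bool) := {r | ¬(r 0 = true ∧ r 1 = false ∧ r 2 = false)}

/-- `R` is NAND-free if no restriction of `R` equals the NAND relation `{01,10,00}`. -/
def NANDFree {k : ℕ} (R : Set (Fin k → Bool)) : Prop := ¬ IsRestriction R nandRel

/-- `R` is OR-free if no restriction of `R` equals the OR relation `{01,10,11}`. -/
def ORFree {k : ℕ} (R : Set (Fin k → Bool)) : Prop := ¬ IsRestriction R orRel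

/-- `R` is dual-Horn-free if no restriction of `R` equals `{0,1}^3 \ {100}`. -/
def DualHornFree {k : ℕ} (R : Set (Fin k → Bool)) : Prop := ¬ IsRestriction R dualHornRel

/-- A flip is a variable together with the value it flips *to*:
`(i, true)` is the positive flip `xᵢ⁺` (0→1), `(i, false)` the negative flip `xᵢ⁻` (1→0). -/
abbrev Flip (α : Type) := α × Bool

/-- Apply a flip to an assignment. -/
def applyFlip {α : Type} [DecidableEq α] (a : α → Bool) (f : Flip α) : α → Bool :=
  Function.update a f.1 f.2

/-- Apply a flip sequence (left to right) to an assignment; `applySeq s F` is `F(s)`. -/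
def applySeq {α : Type} [DecidableEq α] (s : α → Bool) (F : List (Flip α)) : α → Bool :=
  F.foldl applyFlip s

/-- `ValidSeq R s F`: the flip sequence `F` is valid at `s` with respect to `R`, i.e.
each flip in turn is applicable and every intermediate assignment (including `s` and
the final one) lies in `R`. -/
def ValidSeq {α : Type} [DecidableEq α] (R : Set (α → Bool)) :
    (α → Bool) → List (Flip α) → Prop
  | s, [] => s ∈ R
  | s, f :: F => s ∈ R ∧ s f.1 = !f.2 ∧ ValidSeq R (applyFlip s f) F

/-- A flip sequence is *anticanonical* if all its negative flips occur before all its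
positive flips. -/
def IsAntiCanonical {α : Type} (F : List (Flip α)) : Prop :=
  ∃ N P : List (Flip α), F = N ++ P ∧ (∀ f ∈ N, f.2 = false) ∧ (∀ f ∈ P, f.2 = true)

theorem ValidSeq.mem {α : Type} [DecidableEq α] {R : Set (α → Bool)} {s : α → Bool}
    {F : List (Flip α)} (h : ValidSeq R s F) : s ∈ R := by
  cases F with
  | nil => exact h
  | cons f F => exact h.1

/-- In an OR-free relation, the fourth corner of a square whose other three corners lie in the
relation and form an OR also lies in the relation. -/
theorem ORFree.update_false_mem {k : ℕ} {R : Set (Fin k → Bool)} (hR : ORFree R)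
    {s : Fin k → Bool} {i j : Fin k} (hij : i ≠ j) (hi : s i = false) (hj : s j = true)
    (hs : s ∈ R) (hsi : Function.update s i true ∈ R)
    (hsij : Function.update (Function.update s i true) j false ∈ R) :
    Function.update s j false ∈ R := by
  by_contra hsj
  refine hR ⟨?_, fun m => if m = i then .inl 0 else if m = j then .inl 1 else .inr (s m), ?_⟩
  · have := i.isLt
    have := j.isLt
    have := Fin.val_ne_of_ne hij
    omega
  · intro r
    have key : (fun m => Sum.elim r id
        (if m = i then .inl 0 else if m = j then .inl 1 else .inr (s m) : Fin 2 ⊕ Bool)) =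
        Function.update (Function.update s i (r 0)) j (r 1) := by
      funext m
      by_cases hmi : m = i
      · subst hmi
        simp [hij]
      · by_cases hmj : m = j
        · subst hmj
          simp [hmi]
        · simp [hmi, hmj]
    rw [key]
    have ei : Function.update s i false = s := by rw [← hi, Function.update_eq_self]
    have ej : Function.update s j true = s := by rw [← hj, Function.update_eq_self]
    have eij : Function.update (Function.update s i true) j true = Function.update s i true := by
      rw [Function.update_comm hij, ej]
    rcases h0 : r 0 <;> rcases h1 : r 1 <;> simp [orRel, h0, h1, ei, ej, eij, hs, hsi, hsij, hsj]

/-- A positive flip can be moved past a block of negative flips, possibly cancelling with one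
of them. -/
theorem ORFree.exists_anticanonical_cons {k : ℕ} {R : Set (Fin k → Bool)} (hR : ORFree R)
    (i : Fin k) (P : List (Flip (Fin k))) (N : List (Flip (Fin k))) (hN : ∀ f ∈ N, f.2 = false)
    (s : Fin k → Bool) (h : ValidSeq R s ((i, true) :: (N ++ P))) :
    ∃ N' P' : List (Flip (Fin k)), N'.Sublist N ∧ P'.Sublist ((i, true) :: P) ∧
      ValidSeq R s (N' ++ P') ∧
      applySeq s (N' ++ P') = applySeq s ((i, true) :: (N ++ P)) := by
  induction N generalizing s with
  | nil => exact ⟨[], (i, true) :: P, .refl _, .refl _, h, rfl⟩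
  | cons f N ih =>
    obtain ⟨j, b⟩ := f
    obtain rfl : b = false := hN _ List.mem_cons_self
    obtain ⟨hs, hi, hsi, hj, hv⟩ := h
    simp only [applyFlip, Bool.not_true, Bool.not_false] at hi hsi hj hv
    rcases eq_or_ne i j with rfl | hij
    · have e : Function.update (Function.update s i true) i false = s := by
        rw [Function.update_idem, ← hi, Function.update_eq_self]
      refine ⟨N, P, List.sublist_cons_self _ _, List.sublist_cons_self _ _, ?_, ?_⟩
      · exact e ▸ hv
      · simp [applySeq, applyFlip, e]
    · have hj' : s j = true := by rwa [Function.update_of_ne hij.symm] at hj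
      have hsj := hR.update_false_mem hij hi hj' hs hsi hv.mem
      have hc : Function.update (Function.update s i true) j false =
          Function.update (Function.update s j false) i true := Function.update_comm hij _ _ _
      obtain ⟨N', P', hN', hP', hv', he⟩ := ih (fun f hf => hN f (List.mem_cons_of_mem _ hf))
        (Function.update s j false)
        ⟨hsj, by simpa [Function.update_of_ne hij] using hi, by simpa [applyFlip, ← hc] using hv⟩
      refine ⟨(j, false) :: N', P', hN'.cons_cons _, hP', ⟨hs, by simpa using hj', hv'⟩, ?_⟩
      simpa [applySeq, applyFlip, hc] using he

theorem ORFree.exists_neg_append_pos {k : ℕ} {R : Set (Fin k → Bool)} (hR : ORFree R)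
    (F : List (Flip (Fin k))) (s : Fin k → Bool) (hF : ValidSeq R s F) :
    ∃ N P : List (Flip (Fin k)), N.Sublist (F.filter fun f => !f.2) ∧
      P.Sublist (F.filter fun f => f.2) ∧ ValidSeq R s (N ++ P) ∧
      applySeq s (N ++ P) = applySeq s F := by
  induction F generalizing s with
  | nil => exact ⟨[], [], by simp, by simp, hF, rfl⟩
  | cons f F ih =>
    obtain ⟨hs, hf, hv⟩ := hF
    obtain ⟨N, P, hN, hP, hv', he⟩ := ih _ hv
    obtain ⟨i, _ | _⟩ := f
    · exact ⟨(i, false) :: N, P, by simpa using hN, by simpa using hP, ⟨hs, hf, hv'⟩, he⟩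
    · obtain ⟨N', P', hN', hP', hv'', he'⟩ := hR.exists_anticanonical_cons i P N
        (fun f h => by simpa using (List.mem_filter.1 (hN.subset h)).2) s ⟨hs, hf, hv'⟩
      exact ⟨N', P', by simpa using hN'.trans hN, by simpa using hP'.trans (hP.cons_cons _),
        hv'', he'.trans he⟩

/-- For `R` an OR-free relation and `F` a valid flip sequence at `s ∈ R`, there is a
valid flip sequence `F'` equivalent to `F` in which all negative flips occur before all
positive flips, with `C(F') ⊆ C(F)`, preserving the relative order among flips of the
same sign (the positive flips of `F'` form a sublist of those of `F`, and likewise for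
the negative flips). -/
theorem exists_anticanonical_equiv {k : ℕ} (R : Set (Fin k → Bool)) (hR : ORFree R)
    (s : Fin k → Bool) (hs : s ∈ R) (F : List (Flip (Fin k)))
    (hF : ValidSeq R s F) :
    ∃ F' : List (Flip (Fin k)),
      ValidSeq R s F' ∧ applySeq s F' = applySeq s F ∧ IsAntiCanonical F' ∧
      (∀ f ∈ F', f ∈ F) ∧
      List.Sublist (F'.filter (fun f => f.2)) (F.filter (fun f => f.2)) ∧
      List.Sublist (F'.filter (fun f => !f.2)) (F.filter (fun f => !f.2)) := by
  obtain ⟨N, P, hN, hP, hv, he⟩ := hR.exists_neg_append_pos F s hF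
  have hN' : ∀ f ∈ N, f.2 = false := fun f h => by
    simpa using (List.mem_filter.1 (hN.subset h)).2
  have hP' : ∀ f ∈ P, f.2 = true := fun f h => (List.mem_filter.1 (hP.subset h)).2
  refine ⟨N ++ P, hv, he, ⟨N, P, rfl, hN', hP'⟩, fun f h => ?_, ?_, ?_⟩
  · rcases List.mem_append.1 h with h | h
    · exact (List.mem_filter.1 (hN.subset h)).1
    · exact (List.mem_filter.1 (hP.subset h)).1
  · have h : N.filter (fun f => f.2) = [] := by simpa using fun a b h => hN' (a, b) h
    rw [List.filter_append, h, List.nil_append]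
    exact List.filter_sublist.trans hP
  · have h : P.filter (fun f => !f.2) = [] := by simpa using fun a b h => hP' (a, b) h
    rw [List.filter_append, h, List.append_nil]
    exact List.filter_sublist.trans hN
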